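/- Let X be a scheme over a field K, let k ≥ 1 be an integer such that (k+2)! is not divisible by the characteristic of K, and let E be a locally free sheaf over X. Let U = {U_i}_{i∈I} be a Zariski open cover of X and g = {g_{ij}} a system of transition functions associated with a trivialization of E with respect to U. Then the Čech k-cochain f̂_{k,U}(E) with components t_{i_1⋯i_{k+1}} := Σ_{σ∈S_{k+1}} (sgn σ)/(k+1)! · tr( g^{-1}_{i_{σ(1)}i_{σ(k+1)}} dg_{i_{σ(1)}i_{σ(k+1)}} ⋯ g^{-1}_{i_{σ(k)}i_{σ(k+1)}} dg_{i_{σ(k)}i_{σ(k+1)}} ) ∈ Γ(U_{i_1⋯i_{k+1}}, Ω^k) is a Čech k-cocycle; its class f_{k,U}(E) ∈ Ȟ^k(U, Ω^k) is independent of the choice of g, and its image f_k(E) in Ȟ^k(X, Ω^k) under the canonical homomorphism is independent of the choice of U. The class f_k(E) is called the k-th T invariant of E. -/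

import Mathlib

/-!  Čech cocycles of algebraic differential forms built from transition functions
of a locally free sheaf on a scheme over a field `K`, following Fang, "Construct
holomorphic invariants in Čech cohomology by a combinatorial formula", §6.

A scheme `X` over `K` is presented as a scheme together with compatible `K`-algebra
structures on the section rings `Γ(X, U)`.  The differential `k`-forms over an open
`U` are the elements of the `k`-th exterior power `⋀[Γ(X,U)]^k Ω[Γ(X,U)⁄K]` inside
the exterior algebra of the module of Kähler differentials of `Γ(X, U)` over `K`
(where products of forms are wedge products), and the restriction maps of the
presheaf `U ↦ ⋀ Ω[Γ(X,U)⁄K]` of forms are the canonical ring homomorphisms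
determined by `s ↦ s|_V` and `d s ↦ d (s|_V)` on the generators. -/

open AlgebraicGeometry CategoryTheory Opposite

noncomputable section

variable {K : Type} [Field K] {X : Scheme}

/-- The algebra of (algebraic) differential forms on the open set `U` of the scheme
`X` over `K`: the exterior algebra of the module of Kähler differentials of the
section ring `Γ(X, U)` over `K`. -/
def FormAlg (K : Type) [Field K] (X : Scheme)
    [∀ U : X.Opens, Algebra K (X.presheaf.obj (op U))] (U : X.Opens) : Type :=
  ExteriorAlgebra (X.presheaf.obj (op U)) (Ω[(X.presheaf.obj (op U))⁄K])

variable [∀ U : X.Opens, Algebra K (X.presheaf.obj (op U))]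

instance (V : X.Opens) : Ring (FormAlg K X V) :=
  inferInstanceAs (Ring (ExteriorAlgebra (X.presheaf.obj (op V))
    (Ω[(X.presheaf.obj (op V))⁄K])))

instance (V : X.Opens) : Algebra (X.presheaf.obj (op V)) (FormAlg K X V) :=
  inferInstanceAs (Algebra (X.presheaf.obj (op V))
    (ExteriorAlgebra (X.presheaf.obj (op V)) (Ω[(X.presheaf.obj (op V))⁄K])))

/-- `d s`, the universal derivation applied to a section, as a `1`-form. -/
def secD (U : X.Opens) (s : X.presheaf.obj (op U)) : FormAlg K X U :=
  ExteriorAlgebra.ι _ (KaehlerDifferential.D K _ s)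

/-- The submodule of `k`-forms on `U`: the `k`-th exterior power of the module of
Kähler differentials, i.e. the sections over `U` of the sheaf `Ω^k`. -/
def kForms (V : X.Opens) (k : ℕ) :
    Submodule (X.presheaf.obj (op V)) (FormAlg K X V) :=
  ⋀[(X.presheaf.obj (op V))]^k (Ω[(X.presheaf.obj (op V))⁄K])

/-- `t` is a `k`-form on `V` (a section of `Ω^k`). -/
def IsKForm (V : X.Opens) (k : ℕ) (t : FormAlg K X V) : Prop :=
  t ∈ kForms (K := K) V k

/-- The intersection `U_{i₁} ⊓ ⋯ ⊓ U_{i_n}` of the members of a tuple of a cover. -/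
def tupleInf {X : Scheme} {ι : Type} (U : ι → X.Opens) {n : ℕ} (i : Fin n → ι) :
    X.Opens :=
  ⨅ l, U (i l)

/-- The family `res` consists of the canonical restriction homomorphisms of
differential forms: the ring homomorphisms determined on the generators by the
restriction of sections, compatibly with the universal derivations. -/
def IsFormRestriction
    (res : ∀ (U V : X.Opens), V ≤ U → FormAlg K X U →+* FormAlg K X V) : Prop :=
  (∀ (U V : X.Opens) (h : V ≤ U) (s : X.presheaf.obj (op U)),
    res U V h (algebraMap _ _ s) = algebraMap _ _ (X.presheaf.map (homOfLE h).op s)) ∧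
  (∀ (U V : X.Opens) (h : V ≤ U) (s : X.presheaf.obj (op U)),
    res U V h (secD (K := K) U s) = secD (K := K) V (X.presheaf.map (homOfLE h).op s)) ∧
  (∀ (U V W : X.Opens) (h : V ≤ U) (h' : W ≤ V) (t : FormAlg K X U),
    res V W h' (res U V h t) = res U W (h'.trans h) t)

/-- `U` is an open cover of `X` (in the Zariski topology). -/
def IsZariskiCover {ι : Type} (U : ι → X.Opens) : Prop :=
  (⨆ i, U i) = ⊤

/-- A system of (matrix-valued) transition functions associated with a
trivialization of a rank-`M` locally free sheaf `E` with respect to the Zariski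
open cover `U`: invertible `M × M` matrices of sections over the pairwise
intersections satisfying the cocycle condition. -/
structure IsSchTransition {X : Scheme} {M : ℕ} {ι : Type} (U : ι → X.Opens)
    (g : ∀ i j : ι, Matrix (Fin M) (Fin M) (X.presheaf.obj (op (U i ⊓ U j)))) :
    Prop where
  isUnit : ∀ i j, IsUnit (g i j)
  refl : ∀ i, g i i = 1
  cocycle : ∀ i j l : ι,
    (g i j).map (X.presheaf.map (homOfLE (inf_le_left :
        U i ⊓ U j ⊓ U l ≤ U i ⊓ U j)).op) *
      (g j l).map (X.presheaf.map (homOfLE (le_inf (inf_le_left.trans inf_le_right)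
        inf_le_right : U i ⊓ U j ⊓ U l ≤ U j ⊓ U l)).op) =
    (g i l).map (X.presheaf.map (homOfLE (le_inf (inf_le_left.trans inf_le_left)
        inf_le_right : U i ⊓ U j ⊓ U l ≤ U i ⊓ U l)).op)

/-- The restriction of the transition matrix `g_{i_a i_b}` to the intersection
`U_{i₁} ⊓ ⋯ ⊓ U_{i_n}`. -/
def grRes {M : ℕ} {ι : Type} (U : ι → X.Opens)
    (g : ∀ i j : ι, Matrix (Fin M) (Fin M) (X.presheaf.obj (op (U i ⊓ U j))))
    {n : ℕ} (i : Fin n → ι) (a b : Fin n) :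
    Matrix (Fin M) (Fin M) (X.presheaf.obj (op (tupleInf U i))) :=
  (g (i a) (i b)).map (X.presheaf.map (homOfLE (le_inf
    (iInf_le (fun l => U (i l)) a) (iInf_le (fun l => U (i l)) b))).op)

/-- The matrix of `1`-forms `g⁻¹ dg` (entries in the algebra of forms) over the
intersection `U_{i₁} ⊓ ⋯ ⊓ U_{i_n}`. -/
def gInvDg {M : ℕ} {ι : Type} (U : ι → X.Opens)
    (g : ∀ i j : ι, Matrix (Fin M) (Fin M) (X.presheaf.obj (op (U i ⊓ U j))))
    {n : ℕ} (i : Fin n → ι) (a b : Fin n) :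
    Matrix (Fin M) (Fin M) (FormAlg K X (tupleInf U i)) :=
  (grRes U g i a b)⁻¹.map (algebraMap _ _) *
    (grRes U g i a b).map (fun s => secD (K := K) _ s)

/-- The component `t_{i₁⋯i_{k+1}}` of the combinatorial formula, a `k`-form over
`U_{i₁} ⊓ ⋯ ⊓ U_{i_{k+1}}`:
`t = (1/(k+1)!) ∑_{σ ∈ S_{k+1}} sgn σ ·
 tr (g⁻¹_{σ(1)σ(k+1)} dg_{σ(1)σ(k+1)} ⋯ g⁻¹_{σ(k)σ(k+1)} dg_{σ(k)σ(k+1)})`,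
the product being the matrix product of matrices with entries in the exterior
algebra of Kähler differentials (so entries multiply by the wedge product). -/
def schT {M : ℕ} {ι : Type} (U : ι → X.Opens)
    (g : ∀ i j : ι, Matrix (Fin M) (Fin M) (X.presheaf.obj (op (U i ⊓ U j))))
    (k : ℕ) (i : Fin (k+1) → ι) : FormAlg K X (tupleInf U i) :=
  algebraMap (X.presheaf.obj (op (tupleInf U i))) _
      (algebraMap K _ (((k+1).factorial : K)⁻¹)) *
    ∑ σ : Equiv.Perm (Fin (k+1)),
      (Equiv.Perm.sign σ : ℤ) •
        Matrix.trace (List.ofFn fun l : Fin k =>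
          gInvDg (K := K) U g i (σ l.castSucc) (σ (Fin.last k))).prod

/-- The Čech coboundary of a cochain of differential forms. -/
def schD {ι : Type} (U : ι → X.Opens)
    (res : ∀ (U' V' : X.Opens), V' ≤ U' → FormAlg K X U' →+* FormAlg K X V')
    {m : ℕ} (c : ∀ i : Fin m → ι, FormAlg K X (tupleInf U i))
    (i : Fin (m+1) → ι) : FormAlg K X (tupleInf U i) :=
  ∑ j : Fin (m+1), (-1 : ℤ) ^ (j : ℕ) •
    res (tupleInf U fun l => i (j.succAbove l)) (tupleInf U i)
      (le_iInf fun l => iInf_le (fun l' => U (i l')) (j.succAbove l))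
      (c fun l => i (j.succAbove l))

/-- A Čech cochain with values in the sheaf `Ω^k` (the `k`-th exterior power of the
sheaf of Kähler differentials of `X` over `Spec K`). -/
def IsFormCochain {ι : Type} (U : ι → X.Opens) (k : ℕ) {m : ℕ}
    (c : ∀ i : Fin m → ι, FormAlg K X (tupleInf U i)) : Prop :=
  ∀ i, IsKForm (K := K) (tupleInf U i) k (c i)

/-- Two Čech cochains of `k`-forms are cohomologous: they differ by the Čech
coboundary of a cochain with values in `Ω^k`.  Two Čech cocycles define the same
class in the Čech cohomology group `Ȟ^k(𝒰, Ω^k)` iff they are cohomologous. -/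
def SchCohomologous {ι : Type} (U : ι → X.Opens)
    (res : ∀ (U' V' : X.Opens), V' ≤ U' → FormAlg K X U' →+* FormAlg K X V')
    (k : ℕ) {m : ℕ}
    (c c' : ∀ i : Fin (m+1) → ι, FormAlg K X (tupleInf U i)) : Prop :=
  ∃ s : ∀ i : Fin m → ι, FormAlg K X (tupleInf U i),
    IsFormCochain (K := K) U k s ∧
    ∀ i : Fin (m+1) → ι, c' i - c i = schD (K := K) U res s i

/-- `g'`, a system with respect to the cover `V` refining `U` via `r`, is obtained
from the restriction of `g` by the change of trivialization `h`; i.e. `g` and `g'`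
are systems of transition functions associated with trivializations of one and the
same locally free sheaf `E`. -/
def SchSystemsEquiv {X : Scheme} {M : ℕ} {ι κ : Type} (U : ι → X.Opens)
    (V : κ → X.Opens) (r : κ → ι) (hr : ∀ j, V j ≤ U (r j))
    (g : ∀ i j : ι, Matrix (Fin M) (Fin M) (X.presheaf.obj (op (U i ⊓ U j))))
    (g' : ∀ i j : κ, Matrix (Fin M) (Fin M) (X.presheaf.obj (op (V i ⊓ V j)))) :
    Prop :=
  ∃ h : ∀ j : κ, Matrix (Fin M) (Fin M) (X.presheaf.obj (op (V j))),
    (∀ j, IsUnit (h j)) ∧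
    ∀ j₁ j₂ : κ, g' j₁ j₂ =
      ((h j₁).map (X.presheaf.map (homOfLE (inf_le_left : V j₁ ⊓ V j₂ ≤ V j₁)).op))⁻¹ *
        (g (r j₁) (r j₂)).map
          (X.presheaf.map (homOfLE (inf_le_inf (hr j₁) (hr j₂))).op) *
        (h j₂).map (X.presheaf.map (homOfLE (inf_le_right : V j₁ ⊓ V j₂ ≤ V j₂)).op)

end

theorem AlternatingMap.map_sub_apply_of_ne {R M N ι : Type*} [Ring R] [AddCommGroup M] [Module R M]
    [AddCommGroup N] [Module R N] [Fintype ι] [DecidableEq ι] (f : M [⋀^ι]→ₗ[R] N) (u : ι → M)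
    (j : ι) : f (fun a => if a = j then u a else u a - u j) = f u := by
  suffices H : ∀ s : Finset ι, j ∉ s → f (fun a => if a ∈ s then u a - u j else u a) = f u by
    rw [← H (Finset.univ.erase j) (by simp)]
    congr 1
    funext a
    by_cases h : a = j <;> simp [h]
  intro s
  induction s using Finset.induction_on with
  | empty => simp
  | insert a s ha ih =>
    intro hj
    rw [Finset.mem_insert, not_or] at hj
    set v : ι → M := fun b => if b ∈ s then u b - u j else u b with hv
    have hvj : v j = u j := by simp [hv, hj.2]
    have hva : v a = u a := by simp [hv, ha]
    have e : (fun b => if b ∈ insert a s then u b - u j else u b)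
        = Function.update v a (u a - u j) := by
      funext b
      by_cases hb : b = a
      · subst hb; simp
      · simp [hb, hv]
    rw [e, f.map_update_sub, ← hvj, f.map_update_self _ (Ne.symm hj.1), sub_zero, ← hva,
      Function.update_eq_self, ih hj.2]

/-- The antisymmetrized product of `k` elements of a ring. -/
noncomputable def altProd (R : Type*) [Ring R] (k : ℕ) : R [⋀^Fin k]→ₗ[ℤ] R :=
  MultilinearMap.alternatization (MultilinearMap.mkPiAlgebraFin ℤ k R)

theorem altProd_apply {R : Type*} [Ring R] {k : ℕ} (v : Fin k → R) :
    altProd R k v = ∑ σ : Equiv.Perm (Fin k),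
      (Equiv.Perm.sign σ : ℤ) • (List.ofFn fun l => v (σ l)).prod := by
  simp [altProd, MultilinearMap.alternatization_apply, Units.smul_def]

/-- `altProd` as a map of the first components, with an additional argument entering through its
second component. -/
noncomputable def altProdAux (R : Type*) [Ring R] (k : ℕ) :
    (R × ℤ) →ₗ[ℤ] (R × ℤ) [⋀^Fin k]→ₗ[ℤ] R :=
  (LinearMap.snd ℤ R ℤ).smulRight ((altProd R k).compLinearMap (LinearMap.fst ℤ R ℤ))

/-- The alternating sum of `altProd` over the faces of a `(k + 1)`-tuple, as an alternating map. -/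
noncomputable def altProdFaces (R : Type*) [Ring R] (k : ℕ) : (R × ℤ) [⋀^Fin (k + 1)]→ₗ[ℤ] R :=
  AlternatingMap.alternatizeUncurryFin (altProdAux R k)

theorem altProdFaces_apply {R : Type*} [Ring R] {k : ℕ} (u : Fin (k + 1) → R × ℤ) :
    altProdFaces R k u = ∑ j : Fin (k + 1),
      (-1) ^ (j : ℕ) • (u j).2 • altProd R k (fun l => (u (j.succAbove l)).1) := by
  rw [altProdFaces, AlternatingMap.alternatizeUncurryFin_apply]
  rfl

theorem sum_altProdFaces_faces {R : Type*} [Ring R] {k : ℕ} (w : Fin (k + 2) → R) :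
    ∑ j : Fin (k + 2), (-1 : ℤ) ^ (j : ℕ) •
      altProdFaces R k (fun a => (w (j.succAbove a), 1)) = 0 := by
  have h := AlternatingMap.alternatizeUncurryFin_alternatizeUncurryFinLM_comp_of_symmetric
    (f := (LinearMap.snd ℤ R ℤ).smulRight (altProdAux R k)) (fun x y => by
      ext v
      simpa [altProdAux] using (Int.cast_commute x.2 (y.2 : R)).left_comm _)
  have h2 := congrArg (fun F => F (fun a => (w a, (1 : ℤ)))) h
  rw [AlternatingMap.alternatizeUncurryFin_apply] at h2
  refine (Finset.sum_congr rfl fun j _ => ?_).trans h2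
  simp only [altProdFaces, LinearMap.comp_apply, LinearMap.smulRight_apply, LinearMap.snd_apply,
    one_smul, AlternatingMap.alternatizeUncurryFinLM_apply]
  rfl

theorem altProd_swap_sub {R : Type*} [Ring R] {k : ℕ} (w : Fin (k + 1) → R) (p : Fin (k + 1)) :
    altProd R k (fun l => w (Equiv.swap 0 p l.succ) - w p) =
      (if p = 0 then 1 else -1 : ℤ) • altProdFaces R k (fun a => (w a, 1)) := by
  have h1 := (altProdFaces R k).map_perm (fun a => (w a, 1)) (Equiv.swap 0 p)
  have h2 := (altProdFaces R k).map_sub_apply_of_ne ((fun a => (w a, 1)) ∘ Equiv.swap 0 p) 0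
  rw [h1, altProdFaces_apply, Fin.sum_univ_succ] at h2
  have hs : (Equiv.Perm.sign (Equiv.swap 0 p) : ℤ) = if p = 0 then 1 else -1 := by
    by_cases h : p = 0
    · simp [h]
    · simp [h, Equiv.Perm.sign_swap (Ne.symm h)]
  simpa [Units.smul_def, hs, Fin.succ_ne_zero, eq_comm (a := (0 : Fin (k + 1)))] using h2

theorem sum_perm_zero_sub {R : Type*} [Ring R] {k : ℕ} (w : Fin (k + 1) → R) :
    ∑ σ : Equiv.Perm (Fin (k + 1)), (Equiv.Perm.sign σ : ℤ) •
      (List.ofFn fun l : Fin k => w (σ l.succ) - w (σ 0)).prod =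
    ((k : ℤ) + 1) • altProdFaces R k (fun a => (w a, 1)) := by
  rw [← Equiv.sum_comp Equiv.Perm.decomposeFin.symm, Fintype.sum_prod_type]
  have (p : Fin (k + 1)) : ∑ e : Equiv.Perm (Fin k),
      (Equiv.Perm.sign (Equiv.Perm.decomposeFin.symm (p, e)) : ℤ) •
      (List.ofFn fun l : Fin k => w (Equiv.Perm.decomposeFin.symm (p, e) l.succ)
        - w (Equiv.Perm.decomposeFin.symm (p, e) 0)).prod =
      altProdFaces R k (fun a => (w a, 1)) := by
    have h := congrArg (fun z => (if p = 0 then 1 else -1 : ℤ) • z) (altProd_swap_sub w p)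
    simp only [smul_smul] at h
    rw [show ((if p = 0 then 1 else -1 : ℤ) * (if p = 0 then 1 else -1 : ℤ)) = 1 by
      split_ifs <;> rfl, one_smul, altProd_apply, Finset.smul_sum] at h
    rw [← h]
    refine Finset.sum_congr rfl fun e _ => ?_
    rw [Equiv.Perm.decomposeFin.symm_sign, smul_smul]
    simp only [Equiv.Perm.decomposeFin_symm_apply_succ, Equiv.Perm.decomposeFin_symm_apply_zero]
    congr 1
    split_ifs <;> simp
  rw [Finset.sum_congr rfl fun p _ => this p]
  simp

theorem sum_perm_last_sub {R : Type*} [Ring R] {k : ℕ} (w : Fin (k + 1) → R) :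
    ∑ σ : Equiv.Perm (Fin (k + 1)), (Equiv.Perm.sign σ : ℤ) •
      (List.ofFn fun l : Fin k => w (σ (Fin.last k)) - w (σ l.castSucc)).prod =
    ((-1) ^ k * (k + 1) : ℤ) • altProdFaces R k (fun a => (-w a, 1)) := by
  rw [mul_smul, ← sum_perm_zero_sub (fun a => -w a), Finset.smul_sum,
    ← Equiv.sum_comp (Equiv.mulRight (finRotate (k + 1)))]
  refine Finset.sum_congr rfl fun σ _ => ?_
  simp [mul_assoc, mul_comm (_ : ℤ) ((-1) ^ k), neg_add_eq_sub]

theorem Matrix.trace_map_algebraMap_mul_comm {A Λ n : Type*} [CommRing A] [Ring Λ]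
    [Algebra A Λ] [Fintype n] (P : Matrix n n A) (N : Matrix n n Λ) :
    (P.map (algebraMap A Λ) * N).trace = (N * P.map (algebraMap A Λ)).trace := by
  simp only [Matrix.trace, Matrix.diag_apply, Matrix.mul_apply, Matrix.map_apply]
  rw [Finset.sum_comm]
  exact Finset.sum_congr rfl fun i _ => Finset.sum_congr rfl fun j _ => Algebra.commutes _ _

theorem Matrix.map_leibniz {A Λ n : Type*} [CommRing A] [Ring Λ] [Algebra A Λ] [Fintype n]
    (D : A → Λ) (hadd : ∀ a b, D (a + b) = D a + D b)
    (hmul : ∀ a b, D (a * b) = a • D b + b • D a) (P Q : Matrix n n A) :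
    (P * Q).map D = P.map (algebraMap A Λ) * Q.map D + P.map D * Q.map (algebraMap A Λ) := by
  ext i j
  simp only [Matrix.map_apply, Matrix.mul_apply, Matrix.add_apply, ← Finset.sum_add_distrib]
  rw [show D (∑ l, P i l * Q l j) = ∑ l, D (P i l * Q l j) from
    map_sum (AddMonoidHom.mk' D hadd) _ _]
  refine Finset.sum_congr rfl fun l _ => ?_
  rw [hmul, Algebra.smul_def, Algebra.smul_def, Algebra.commutes (Q l j)]

/-- The matrix `g⁻¹ dg` attached to a matrix `g` over a ring `A` and a map `D : A → Λ` to an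
`A`-algebra. -/
noncomputable def maurerCartan {A Λ n : Type*} [CommRing A] [Ring Λ] [Algebra A Λ] [Fintype n]
    [DecidableEq n] (D : A → Λ) (G : Matrix n n A) : Matrix n n Λ :=
  G⁻¹.map (algebraMap A Λ) * G.map D

/-- The alternating sum of the traces of products of matrices `g⁻¹ dg` over a tuple `x` of
indices of a system of matrices. -/
noncomputable def traceSum {A Λ n I : Type*} [CommRing A] [Ring Λ] [Algebra A Λ] [Fintype n]
    [DecidableEq n] (D : A → Λ) (G : I → I → Matrix n n A) {k : ℕ} (x : Fin (k + 1) → I) : Λ :=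
  ∑ σ : Equiv.Perm (Fin (k + 1)), (Equiv.Perm.sign σ : ℤ) •
    Matrix.trace (List.ofFn fun l : Fin k =>
      maurerCartan D (G (x (σ l.castSucc)) (x (σ (Fin.last k))))).prod

section

variable {A Λ n I : Type*} [CommRing A] [Ring Λ] [Algebra A Λ] [Fintype n] [DecidableEq n]

theorem List.prod_ofFn_conj {S : Type*} [Monoid S] {P Q : S} (h : P * Q = 1) (h' : Q * P = 1)
    {k : ℕ} (N : Fin k → S) :
    (List.ofFn fun l => Q * N l * P).prod = Q * (List.ofFn N).prod * P := by
  induction k with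
  | zero => simp [h']
  | succ k ih =>
    rw [List.ofFn_succ, List.prod_cons, ih, List.ofFn_succ, List.prod_cons]
    simp only [mul_assoc]
    rw [← mul_assoc P Q, h, one_mul]

theorem Matrix.map_algebraMap_mul_inv {P : Matrix n n A} (hP : IsUnit P) :
    P.map (algebraMap A Λ) * P⁻¹.map (algebraMap A Λ) = 1 := by
  rw [← Matrix.map_mul, Matrix.mul_nonsing_inv _ ((Matrix.isUnit_iff_isUnit_det _).1 hP),
    Matrix.map_one _ (map_zero _) (map_one _)]

theorem Matrix.map_algebraMap_inv_mul {P : Matrix n n A} (hP : IsUnit P) :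
    P⁻¹.map (algebraMap A Λ) * P.map (algebraMap A Λ) = 1 := by
  rw [← Matrix.map_mul, Matrix.nonsing_inv_mul _ ((Matrix.isUnit_iff_isUnit_det _).1 hP),
    Matrix.map_one _ (map_zero _) (map_one _)]

theorem maurerCartan_of_mul_eq {D : A → Λ} (hadd : ∀ a b, D (a + b) = D a + D b)
    (hmul : ∀ a b, D (a * b) = a • D b + b • D a) {P Q G : Matrix n n A} (hP : IsUnit P)
    (hQ : IsUnit Q) (h : P * G = Q) :
    maurerCartan D G = Q⁻¹.map (algebraMap A Λ) *
      (Q.map D * Q⁻¹.map (algebraMap A Λ) - P.map D * P⁻¹.map (algebraMap A Λ)) *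
      Q.map (algebraMap A Λ) := by
  have hPd := (Matrix.isUnit_iff_isUnit_det _).1 hP
  have hQd := (Matrix.isUnit_iff_isUnit_det _).1 hQ
  have hG : G = P⁻¹ * Q := by rw [← h, ← mul_assoc, Matrix.nonsing_inv_mul _ hPd, one_mul]
  have hGi : G⁻¹ = Q⁻¹ * P := by
    apply Matrix.inv_eq_left_inv
    rw [mul_assoc, h, Matrix.nonsing_inv_mul _ hQd]
  have hD := congrArg (fun N => N.map D) h
  simp only [Matrix.map_leibniz D hadd hmul] at hD
  have hPG := congrArg (fun N => N.map (algebraMap A Λ)) hG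
  simp only [Matrix.map_mul] at hPG
  rw [maurerCartan, hGi, Matrix.map_mul, mul_assoc, eq_sub_of_add_eq hD, hPG]
  simp only [mul_sub, sub_mul, mul_assoc, Matrix.map_algebraMap_inv_mul hQ, mul_one]

/-- The traces of products of matrices `g⁻¹ dg` built from matrices satisfying the cocycle
condition have vanishing alternating sum. -/
theorem sum_traceSum_faces {D : A → Λ} (hadd : ∀ a b, D (a + b) = D a + D b)
    (hmul : ∀ a b, D (a * b) = a • D b + b • D a) {G : I → I → Matrix n n A}
    (hG : ∀ a b, IsUnit (G a b)) (hG' : ∀ a b c, G a b * G b c = G a c)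
    {k : ℕ} (x : Fin (k + 2) → I) :
    ∑ j : Fin (k + 2), (-1 : ℤ) ^ (j : ℕ) • traceSum D G (fun a => x (j.succAbove a)) = 0 := by
  set ω : I → Matrix n n Λ := fun a =>
    (G (x 0) a).map D * (G (x 0) a)⁻¹.map (algebraMap A Λ) with hω
  have key (y : Fin (k + 1) → I) : traceSum D G y = Matrix.traceAddMonoidHom n Λ
      (((-1) ^ k * (k + 1) : ℤ) • altProdFaces (Matrix n n Λ) k (fun a => (-ω (y a), 1))) := by
    rw [← sum_perm_last_sub (fun a => ω (y a)), map_sum, traceSum]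
    refine Finset.sum_congr rfl fun σ _ => ?_
    rw [map_zsmul, Matrix.traceAddMonoidHom_apply]
    congr 1
    simp only [maurerCartan_of_mul_eq hadd hmul (hG (x 0) _) (hG (x 0) _) (hG' (x 0) _ _)]
    rw [List.prod_ofFn_conj (Matrix.map_algebraMap_mul_inv (hG _ _))
      (Matrix.map_algebraMap_inv_mul (hG _ _)), mul_assoc, Matrix.trace_map_algebraMap_mul_comm,
      mul_assoc, Matrix.map_algebraMap_mul_inv (hG _ _), mul_one]
  simp only [key, ← map_zsmul]
  rw [← map_sum]
  simp only [smul_comm _ ((-1) ^ k * (k + 1) : ℤ)]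
  rw [← Finset.smul_sum, sum_altProdFaces_faces (fun a => -ω (x a)), smul_zero, map_zero]

end

theorem Fin.val_succAbove_eq_ite {n : ℕ} (p : Fin (n + 1)) (i : Fin n) :
    (p.succAbove i : ℕ) = if (i : ℕ) < p then (i : ℕ) else i + 1 := by
  unfold Fin.succAbove
  split_ifs <;> simp_all [Fin.lt_def]

theorem Fin.val_predAbove_eq_ite {n : ℕ} (p : Fin n) (i : Fin (n + 1)) :
    (p.predAbove i : ℕ) = if (p : ℕ) < i then (i : ℕ) - 1 else i := by
  unfold Fin.predAbove
  simp only [Fin.lt_def, Fin.val_castSucc]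
  split_ifs <;> simp

/-- The prism with vertices `(x₀, 0), …, (x_l, 0), (x_l, 1), …`. -/
def prism {I : Type*} {k : ℕ} (x : Fin k → I) (l : Fin k) (m : Fin (k + 1)) : I × Bool :=
  (x (l.predAbove m), decide (l.castSucc < m))

theorem prism_castSucc_succAbove {I : Type*} {k : ℕ} (x : Fin (k + 1) → I) (l : Fin (k + 1)) :
    (fun a => prism x l (l.castSucc.succAbove a)) =
      fun a => (x a, decide (l.castSucc ≤ a.castSucc)) := by
  funext a
  rw [prism, Fin.predAbove_succAbove]
  congr 2
  simp [Fin.lt_succAbove_iff_le_castSucc]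

theorem prism_succ_succAbove {I : Type*} {k : ℕ} (x : Fin (k + 1) → I) (l : Fin (k + 1)) :
    (fun a => prism x l (l.succ.succAbove a)) =
      fun a => (x a, decide (l.succ ≤ a.castSucc)) := by
  funext a
  refine Prod.ext (congrArg x ?_) ?_
  · simp only [Fin.ext_iff, Fin.val_predAbove_eq_ite, Fin.val_succAbove_eq_ite, Fin.val_succ]
    grind
  · simp only [prism, Fin.val_succAbove_eq_ite, Fin.lt_def, Fin.le_def, decide_eq_decide,
      Fin.val_castSucc, Fin.val_succ]
    grind

theorem prism_succAbove {I : Type*} {k : ℕ} (x : Fin (k + 1) → I) (l : Fin k) (j : Fin (k + 1)) :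
    (fun a => prism x (j.succAbove l) (((j.succAbove l).castSucc.succAbove j).succAbove a)) =
      prism (fun a => x (j.succAbove a)) l := by
  funext a
  refine Prod.ext (congrArg x ?_) ?_
  · simp only [Fin.ext_iff, Fin.val_predAbove_eq_ite, Fin.val_succAbove_eq_ite, Fin.val_castSucc]
    grind
  · simp only [prism, Fin.val_succAbove_eq_ite, Fin.lt_def, decide_eq_decide, Fin.val_castSucc]
    grind

theorem neg_one_pow_succAbove_add_succAbove {k : ℕ} (l : Fin k) (j : Fin (k + 1)) :
    (-1 : ℤ) ^ (j.succAbove l : ℕ) * (-1) ^ ((j.succAbove l).castSucc.succAbove j : ℕ) =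
      -((-1) ^ (j : ℕ) * (-1) ^ (l : ℕ)) := by
  rcases lt_or_ge l.castSucc j with h | h
  · rw [Fin.succAbove_of_castSucc_lt _ _ h, Fin.succAbove_of_le_castSucc _ _
      (Fin.castSucc_le_castSucc_iff.2 h.le)]
    simp [pow_succ, mul_comm]
  · rw [Fin.succAbove_of_le_castSucc _ _ h, Fin.succAbove_of_castSucc_lt _ _
      (Fin.castSucc_lt_castSucc_iff.2 (Fin.le_castSucc_iff.1 h))]
    simp [pow_succ, mul_comm]

theorem sum_prism {I Λ : Type*} [AddCommGroup Λ] {k : ℕ} (F : (Fin (k + 1) → I × Bool) → Λ)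
    (hF : ∀ y : Fin (k + 2) → I × Bool,
      ∑ j : Fin (k + 2), (-1 : ℤ) ^ (j : ℕ) • F (fun a => y (j.succAbove a)) = 0)
    (x : Fin (k + 1) → I) :
    F (fun a => (x a, true)) - F (fun a => (x a, false)) =
      ∑ j : Fin (k + 1), (-1 : ℤ) ^ (j : ℕ) • ∑ l : Fin k, (-1 : ℤ) ^ (l : ℕ) •
        F (prism (fun a => x (j.succAbove a)) l) := by
  set q : Fin (k + 2) → Λ := fun m => F (fun a => (x a, decide (m ≤ a.castSucc))) with hq
  set φ : Fin (k + 1) → Fin (k + 1) → Λ := fun l j =>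
    ((-1 : ℤ) ^ (l : ℕ) * (-1) ^ (l.castSucc.succAbove j : ℕ)) •
      F (fun a => prism x l ((l.castSucc.succAbove j).succAbove a)) with hφ
  have h1 (l : Fin (k + 1)) : q l.castSucc + ∑ j, φ l j = 0 := by
    have h := congrArg (fun z => (-1 : ℤ) ^ (l : ℕ) • z) (hF (prism x l))
    simp only [smul_zero] at h
    rw [Fin.sum_univ_succAbove _ l.castSucc, prism_castSucc_succAbove, smul_add, smul_smul,
      Fin.val_castSucc, ← mul_pow, neg_one_mul, neg_neg, one_pow, one_smul, Finset.smul_sum] at h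
    simpa only [smul_smul] using h
  have h2 (l : Fin (k + 1)) : φ l l = -q l.succ := by
    simp only [hφ, hq, Fin.succAbove_castSucc_self, prism_succ_succAbove]
    rw [Fin.val_succ, pow_succ, ← mul_assoc, ← mul_pow]
    simp
  have h3 (j : Fin (k + 1)) (l : Fin k) : φ (j.succAbove l) j =
      -((-1 : ℤ) ^ (j : ℕ) • (-1 : ℤ) ^ (l : ℕ) • F (prism (fun a => x (j.succAbove a)) l)) := by
    simp only [hφ, prism_succAbove]
    rw [neg_one_pow_succAbove_add_succAbove, neg_smul, mul_smul]
  have h4 : ∑ l, (q l.castSucc + ∑ j, φ l j) = 0 := Finset.sum_eq_zero fun l _ => h1 l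
  rw [Finset.sum_add_distrib, Finset.sum_comm] at h4
  simp only [fun j => Fin.sum_univ_succAbove (fun l => φ l j) j, h2, h3,
    Finset.sum_add_distrib, Finset.sum_neg_distrib] at h4
  have h5 : q 0 + ∑ l : Fin (k + 1), q l.succ =
      ∑ l : Fin (k + 1), q l.castSucc + q (Fin.last _) := by
    rw [← Fin.sum_univ_succ, Fin.sum_univ_castSucc]
  have h6 : q 0 = F (fun a => (x a, true)) := by simp [hq]
  have h7 : q (Fin.last _) = F (fun a => (x a, false)) := by
    simp [hq, Fin.last_le_iff]
  rw [← h6, ← h7]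
  simp only [Finset.smul_sum]
  rw [← sub_eq_zero, ← h4, eq_sub_of_add_eq h5]
  abel

theorem traceSum_congr {A Λ n I J : Type*} [CommRing A] [Ring Λ] [Algebra A Λ] [Fintype n]
    [DecidableEq n] (D : A → Λ) {G : I → I → Matrix n n A} {G' : J → J → Matrix n n A} {k : ℕ}
    {x : Fin (k + 1) → I} {y : Fin (k + 1) → J} (h : ∀ a b, G (x a) (x b) = G' (y a) (y b)) :
    traceSum D G x = traceSum D G' y := by
  simp only [traceSum, h]

theorem Matrix.map_ringHom_inv {A B n : Type*} [CommRing A] [CommRing B] [Fintype n]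
    [DecidableEq n] (φ : A →+* B) {P : Matrix n n A} (hP : IsUnit P) :
    P⁻¹.map φ = (P.map φ)⁻¹ := by
  symm
  apply Matrix.inv_eq_right_inv
  rw [← Matrix.map_mul, Matrix.mul_nonsing_inv _ ((Matrix.isUnit_iff_isUnit_det _).1 hP),
    Matrix.map_one _ (map_zero _) (map_one _)]

theorem Matrix.isUnit_map_ringHom {A B n : Type*} [CommRing A] [CommRing B] [Fintype n]
    [DecidableEq n] (φ : A →+* B) {P : Matrix n n A} (hP : IsUnit P) : IsUnit (P.map φ) :=
  hP.map φ.mapMatrix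

theorem map_traceSum {A B Λ Λ' n I : Type*} [CommRing A] [CommRing B] [Ring Λ] [Ring Λ']
    [Algebra A Λ] [Algebra B Λ'] [Fintype n] [DecidableEq n] (φ : A →+* B) (ψ : Λ →+* Λ')
    {D : A → Λ} {D' : B → Λ'} (hψ : ∀ a, ψ (algebraMap A Λ a) = algebraMap B Λ' (φ a))
    (hD : ∀ a, ψ (D a) = D' (φ a)) {G : I → I → Matrix n n A} (hG : ∀ a b, IsUnit (G a b))
    {k : ℕ} (x : Fin (k + 1) → I) :
    ψ (traceSum D G x) = traceSum D' (fun a b => (G a b).map φ) x := by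
  have hmc (a b : I) : ψ.mapMatrix (maurerCartan D (G a b)) =
      maurerCartan D' ((G a b).map φ) := by
    rw [maurerCartan, map_mul, maurerCartan, ← Matrix.map_ringHom_inv φ (hG a b)]
    congr 1 <;> ext <;> simp [hψ, hD]
  rw [traceSum, map_sum, traceSum]
  refine Finset.sum_congr rfl fun σ _ => ?_
  rw [map_zsmul]
  congr 1
  rw [AddMonoidHom.map_trace ψ, show ∀ N : Matrix n n Λ, N.map ψ = ψ.mapMatrix N from fun _ => rfl,
    map_list_prod, List.map_ofFn]
  simp only [Function.comp_def, hmc]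

theorem traceSum_mem_pow {A Λ n I : Type*} [CommRing A] [Ring Λ] [Algebra A Λ] [Fintype n]
    [DecidableEq n] {D : A → Λ} {P : Submodule A Λ} (hD : ∀ a, D a ∈ P)
    (G : I → I → Matrix n n A) {k : ℕ} (x : Fin (k + 1) → I) : traceSum D G x ∈ P ^ k := by
  have hmc (N : Matrix n n A) (i j : n) : maurerCartan D N i j ∈ P := by
    rw [maurerCartan, Matrix.mul_apply]
    refine Submodule.sum_mem _ fun l _ => ?_
    rw [Matrix.map_apply, ← Algebra.smul_def]
    exact P.smul_mem _ (hD _)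
  have hprod (m : ℕ) (N : Fin m → Matrix n n Λ) (hN : ∀ l i j, N l i j ∈ P) (i j : n) :
      (List.ofFn N).prod i j ∈ P ^ m := by
    induction m generalizing i with
    | zero =>
      rw [List.ofFn_zero, List.prod_nil, pow_zero, Matrix.one_apply]
      split_ifs
      · exact Submodule.mem_one.2 ⟨1, map_one _⟩
      · exact Submodule.zero_mem _
    | succ m ih =>
      rw [List.ofFn_succ, List.prod_cons, Matrix.mul_apply, pow_succ']
      exact Submodule.sum_mem _ fun l _ =>
        Submodule.mul_mem_mul (hN _ _ _) (ih _ (fun l => hN l.succ) l)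
  exact Submodule.sum_mem _ fun σ _ => zsmul_mem
    (Submodule.sum_mem _ fun i _ => hprod k _ (fun _ => hmc _) i i) _

/-- The system of matrices over a doubled index set obtained from the system `G` by the changes
of trivialization `h`. -/
noncomputable def twistSystem {A n I J : Type*} [CommRing A] [Fintype n] [DecidableEq n]
    (G : I → I → Matrix n n A) (h : I → J → Matrix n n A) (p q : I × J) : Matrix n n A :=
  (h p.1 p.2)⁻¹ * G p.1 q.1 * h q.1 q.2

theorem isUnit_twistSystem {A n I J : Type*} [CommRing A] [Fintype n] [DecidableEq n]
    {G : I → I → Matrix n n A} {h : I → J → Matrix n n A} (hG : ∀ a b, IsUnit (G a b))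
    (hh : ∀ a j, IsUnit (h a j)) (p q : I × J) : IsUnit (twistSystem G h p q) :=
  ((Matrix.isUnit_nonsing_inv_iff.2 (hh _ _)).mul (hG _ _)).mul (hh _ _)

theorem twistSystem_mul {A n I J : Type*} [CommRing A] [Fintype n] [DecidableEq n]
    {G : I → I → Matrix n n A} {h : I → J → Matrix n n A} (hG : ∀ a b c, G a b * G b c = G a c)
    (hh : ∀ a j, IsUnit (h a j)) (p q s : I × J) :
    twistSystem G h p q * twistSystem G h q s = twistSystem G h p s := by
  have := (Matrix.isUnit_iff_isUnit_det _).1 (hh q.1 q.2)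
  simp only [twistSystem, mul_assoc]
  rw [← mul_assoc (h q.1 q.2), Matrix.mul_nonsing_inv _ this, one_mul, ← mul_assoc (G p.1 q.1), hG]

theorem twistSystem_map {A B n I J : Type*} [CommRing A] [CommRing B] [Fintype n] [DecidableEq n]
    (φ : A →+* B) (G : I → I → Matrix n n A) {h : I → J → Matrix n n A}
    (hh : ∀ a j, IsUnit (h a j)) (p q : I × J) :
    (twistSystem G h p q).map φ =
      twistSystem (fun a b => (G a b).map φ) (fun a j => (h a j).map φ) p q := by
  simp only [twistSystem, Matrix.map_mul, Matrix.map_ringHom_inv φ (hh _ _)]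

section

variable {K : Type} [Field K] {X : Scheme} [∀ U : X.Opens, Algebra K (X.presheaf.obj (op U))]

theorem secD_add (U : X.Opens) (a b : X.presheaf.obj (op U)) :
    secD (K := K) U (a + b) = secD U a + secD U b := by
  rw [secD, map_add]
  exact map_add (ExteriorAlgebra.ι _) _ _

theorem secD_mul (U : X.Opens) (a b : X.presheaf.obj (op U)) :
    secD (K := K) U (a * b) = a • secD U b + b • secD U a := by
  rw [secD, Derivation.leibniz]
  refine (map_add (ExteriorAlgebra.ι _) _ _).trans ?_
  rw [map_smul, map_smul]
  rfl

/-- The restriction homomorphism of sections. -/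
def secRes {U V : X.Opens} (h : V ≤ U) : X.presheaf.obj (op U) →+* X.presheaf.obj (op V) :=
  (X.presheaf.map (homOfLE h).op).hom

theorem secRes_secRes {U V W : X.Opens} (h : V ≤ U) (h' : W ≤ V) (s : X.presheaf.obj (op U)) :
    secRes h' (secRes h s) = secRes (h'.trans h) s := by
  simp only [secRes, ← CommRingCat.comp_apply, ← Functor.map_comp]
  rfl

theorem map_secRes_secRes {M : ℕ} {U V W : X.Opens} (h : V ≤ U) (h' : W ≤ V)
    (N : Matrix (Fin M) (Fin M) (X.presheaf.obj (op U))) :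
    (N.map (secRes h)).map (secRes h') = N.map (secRes (h'.trans h)) := by
  ext i j
  exact secRes_secRes h h' _

theorem IsSchTransition.map_mul {M : ℕ} {ι : Type} {U : ι → X.Opens}
    {g : ∀ i j : ι, Matrix (Fin M) (Fin M) (X.presheaf.obj (op (U i ⊓ U j)))}
    (hg : IsSchTransition U g) {W : X.Opens} (a b c : ι) (hab : W ≤ U a ⊓ U b)
    (hbc : W ≤ U b ⊓ U c) (hac : W ≤ U a ⊓ U c) :
    (g a b).map (secRes hab) * (g b c).map (secRes hbc) = (g a c).map (secRes hac) := by
  have hW : W ≤ U a ⊓ U b ⊓ U c := le_inf hab (hbc.trans inf_le_right)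
  have h := congrArg (fun N => N.map (secRes hW)) (hg.cocycle a b c)
  simp only [Matrix.map_mul] at h
  exact ((congrArg₂ _ (map_secRes_secRes _ _ _) (map_secRes_secRes _ _ _)).symm.trans h).trans
    (map_secRes_secRes _ _ _)

/-- The normalized sum of traces of products of matrices `g⁻¹ dg` for a system of matrices of
sections over a single open set. -/
noncomputable def normTraceSum (K : Type) [Field K] {X : Scheme}
    [∀ U : X.Opens, Algebra K (X.presheaf.obj (op U))] {M : ℕ} {I : Type} (W : X.Opens)
    (G : I → I → Matrix (Fin M) (Fin M) (X.presheaf.obj (op W))) {k : ℕ}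
    (x : Fin (k + 1) → I) : FormAlg K X W :=
  algebraMap (X.presheaf.obj (op W)) _ (algebraMap K _ (((k+1).factorial : K)⁻¹)) *
    traceSum (secD (K := K) W) G x

theorem schT_eq_normTraceSum {M : ℕ} {ι : Type} (U : ι → X.Opens)
    (g : ∀ i j : ι, Matrix (Fin M) (Fin M) (X.presheaf.obj (op (U i ⊓ U j))))
    (k : ℕ) (i : Fin (k + 1) → ι) :
    schT (K := K) U g k i = normTraceSum K (tupleInf U i) (grRes U g i) id :=
  rfl

theorem normTraceSum_congr {M : ℕ} {I J : Type} (W : X.Opens)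
    {G : I → I → Matrix (Fin M) (Fin M) (X.presheaf.obj (op W))}
    {G' : J → J → Matrix (Fin M) (Fin M) (X.presheaf.obj (op W))} {k : ℕ}
    {x : Fin (k + 1) → I} {y : Fin (k + 1) → J} (h : ∀ a b, G (x a) (x b) = G' (y a) (y b)) :
    normTraceSum K W G x = normTraceSum K W G' y := by
  rw [normTraceSum, traceSum_congr _ h, normTraceSum]

theorem isKForm_normTraceSum {M : ℕ} {I : Type} (W : X.Opens)
    (G : I → I → Matrix (Fin M) (Fin M) (X.presheaf.obj (op W))) {k : ℕ}
    (x : Fin (k + 1) → I) : IsKForm W k (normTraceSum K W G x) := by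
  rw [IsKForm, normTraceSum, ← Algebra.smul_def]
  exact Submodule.smul_mem _ _ (traceSum_mem_pow
    (P := LinearMap.range (ExteriorAlgebra.ι (X.presheaf.obj (op W))
      (M := Ω[(X.presheaf.obj (op W))⁄K]))) (fun a => ⟨_, rfl⟩) G x)

theorem isFormCochain_schT {M : ℕ} {ι : Type} (U : ι → X.Opens)
    (g : ∀ i j : ι, Matrix (Fin M) (Fin M) (X.presheaf.obj (op (U i ⊓ U j)))) (k : ℕ) :
    IsFormCochain (K := K) U k (schT (K := K) U g k) := by
  intro i
  rw [schT_eq_normTraceSum]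
  exact isKForm_normTraceSum _ _ _

theorem sum_normTraceSum_faces {M : ℕ} {I : Type} (W : X.Opens)
    {G : I → I → Matrix (Fin M) (Fin M) (X.presheaf.obj (op W))} (hG : ∀ a b, IsUnit (G a b))
    (hG' : ∀ a b c, G a b * G b c = G a c) {k : ℕ} (x : Fin (k + 2) → I) :
    ∑ j : Fin (k + 2), (-1 : ℤ) ^ (j : ℕ) •
      normTraceSum K W G (fun a => x (j.succAbove a)) = 0 := by
  simp only [normTraceSum, ← mul_smul_comm]
  rw [← Finset.mul_sum, sum_traceSum_faces (secD_add W) (secD_mul W) hG hG', mul_zero]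

theorem res_normTraceSum
    (halg : ∀ (U V : X.Opens) (h : V ≤ U) (a : K),
      X.presheaf.map (homOfLE h).op (algebraMap K _ a) = algebraMap K _ a)
    {res : ∀ (U V : X.Opens), V ≤ U → FormAlg K X U →+* FormAlg K X V}
    (hres : IsFormRestriction (K := K) res) {M : ℕ} {I : Type} {U V : X.Opens} (h : V ≤ U)
    {G : I → I → Matrix (Fin M) (Fin M) (X.presheaf.obj (op U))} (hG : ∀ a b, IsUnit (G a b))
    {k : ℕ} (x : Fin (k + 1) → I) :
    res U V h (normTraceSum K U G x) =
      normTraceSum K V (fun a b => (G a b).map (secRes h)) x := by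
  rw [normTraceSum, map_mul, normTraceSum, hres.1, halg]
  congr 1
  exact map_traceSum (secRes h) (res U V h) (hres.1 U V h) (hres.2.1 U V h) hG x

theorem IsSchTransition.isUnit_grRes {M : ℕ} {ι : Type} {U : ι → X.Opens}
    {g : ∀ i j : ι, Matrix (Fin M) (Fin M) (X.presheaf.obj (op (U i ⊓ U j)))}
    (hg : IsSchTransition U g) {n : ℕ} (i : Fin n → ι) (a b : Fin n) :
    IsUnit (grRes U g i a b) :=
  Matrix.isUnit_map_ringHom (secRes _) (hg.isUnit _ _)

theorem res_schT_self
    (halg : ∀ (U V : X.Opens) (h : V ≤ U) (a : K),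
      X.presheaf.map (homOfLE h).op (algebraMap K _ a) = algebraMap K _ a)
    {res : ∀ (U V : X.Opens), V ≤ U → FormAlg K X U →+* FormAlg K X V}
    (hres : IsFormRestriction (K := K) res) (k : ℕ) {M : ℕ} {ι : Type} {U : ι → X.Opens}
    {g : ∀ i j : ι, Matrix (Fin M) (Fin M) (X.presheaf.obj (op (U i ⊓ U j)))}
    (hg : IsSchTransition U g) (i : Fin (k + 1) → ι) (h : tupleInf U i ≤ tupleInf U i) :
    res _ _ h (schT (K := K) U g k i) = schT (K := K) U g k i := by
  rw [schT_eq_normTraceSum]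
  exact (res_normTraceSum halg hres h (hg.isUnit_grRes i) id).trans
    (normTraceSum_congr _ fun a b => map_secRes_secRes _ _ _)

theorem schD_schT_eq_zero
    (halg : ∀ (U V : X.Opens) (h : V ≤ U) (a : K),
      X.presheaf.map (homOfLE h).op (algebraMap K _ a) = algebraMap K _ a)
    {res : ∀ (U V : X.Opens), V ≤ U → FormAlg K X U →+* FormAlg K X V}
    (hres : IsFormRestriction (K := K) res) (k : ℕ) {M : ℕ} {ι : Type} {U : ι → X.Opens}
    {g : ∀ i j : ι, Matrix (Fin M) (Fin M) (X.presheaf.obj (op (U i ⊓ U j)))}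
    (hg : IsSchTransition U g) (i : Fin (k + 2) → ι) :
    schD (K := K) U res (schT (K := K) U g k) i = 0 := by
  rw [schD, ← sum_normTraceSum_faces (K := K) (tupleInf U i) (hg.isUnit_grRes i)
    (fun a b c => hg.map_mul _ _ _ _ _ _) id]
  refine Finset.sum_congr rfl fun j _ => ?_
  exact congrArg (fun z => (-1 : ℤ) ^ (j : ℕ) • z)
    ((res_normTraceSum halg hres _ (hg.isUnit_grRes _) id).trans
      (normTraceSum_congr _ fun a b => map_secRes_secRes _ _ _))

theorem schCohomologous_of_refinement
    (halg : ∀ (U V : X.Opens) (h : V ≤ U) (a : K),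
      X.presheaf.map (homOfLE h).op (algebraMap K _ a) = algebraMap K _ a)
    {res : ∀ (U V : X.Opens), V ≤ U → FormAlg K X U →+* FormAlg K X V}
    (hres : IsFormRestriction (K := K) res) (k : ℕ) {M : ℕ} {ι κ : Type} {U : ι → X.Opens}
    {g : ∀ i j : ι, Matrix (Fin M) (Fin M) (X.presheaf.obj (op (U i ⊓ U j)))}
    (hg : IsSchTransition U g) (V : κ → X.Opens) (r : κ → ι) (hr : ∀ j, V j ≤ U (r j))
    (g' : ∀ i j : κ, Matrix (Fin M) (Fin M) (X.presheaf.obj (op (V i ⊓ V j))))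
    (hgg' : SchSystemsEquiv U V r hr g g') :
    SchCohomologous (K := K) V res k
      (fun i => res (tupleInf U fun l => r (i l)) (tupleInf V i)
        (le_iInf fun l => (iInf_le (fun l' => V (i l')) l).trans (hr (i l)))
        (schT (K := K) U g k (fun l => r (i l))))
      (schT (K := K) V g' k) := by
  obtain ⟨h, hu, hgg'⟩ := hgg'
  have hV {n : ℕ} (i : Fin n → κ) (a : Fin n) : tupleInf V i ≤ V (i a) :=
    iInf_le (fun l => V (i l)) a
  have hVU {n : ℕ} (i : Fin n → κ) (a b : Fin n) :
      tupleInf V i ≤ U (r (i a)) ⊓ U (r (i b)) :=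
    le_inf ((hV i a).trans (hr _)) ((hV i b).trans (hr _))
  let G {n : ℕ} (i : Fin n → κ) (a b : Fin n) :
      Matrix (Fin M) (Fin M) (X.presheaf.obj (op (tupleInf V i))) :=
    (g (r (i a)) (r (i b))).map (secRes (hVU i a b))
  let H {n : ℕ} (i : Fin n → κ) (a : Fin n) (e : Bool) :
      Matrix (Fin M) (Fin M) (X.presheaf.obj (op (tupleInf V i))) :=
    if e then (h (i a)).map (secRes (hV i a)) else 1
  have hG {n : ℕ} (i : Fin n → κ) (a b : Fin n) : IsUnit (G i a b) :=
    Matrix.isUnit_map_ringHom (secRes _) (hg.isUnit _ _)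
  have hG' {n : ℕ} (i : Fin n → κ) (a b c : Fin n) : G i a b * G i b c = G i a c :=
    hg.map_mul _ _ _ _ _ _
  have hH {n : ℕ} (i : Fin n → κ) (a : Fin n) (e : Bool) : IsUnit (H i a e) := by
    cases e
    · exact isUnit_one
    · exact Matrix.isUnit_map_ringHom (secRes _) (hu _)
  refine ⟨fun i => ∑ l : Fin k, (-1 : ℤ) ^ (l : ℕ) •
    normTraceSum K (tupleInf V i) (twistSystem (G i) (H i)) (prism id l),
    fun i => Submodule.sum_mem _ fun l _ => zsmul_mem (isKForm_normTraceSum _ _ _) _,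
    fun i => ?_⟩
  have key := sum_prism (normTraceSum K (tupleInf V i) (twistSystem (G i) (H i)))
    (fun y => sum_normTraceSum_faces _ (isUnit_twistSystem (hG i) (hH i))
      (twistSystem_mul (hG' i) (hH i)) y) (id : Fin (k + 1) → Fin (k + 1))
  have hT' : schT (K := K) V g' k i =
      normTraceSum K (tupleInf V i) (twistSystem (G i) (H i)) (fun a => (a, true)) := by
    rw [schT_eq_normTraceSum]
    refine normTraceSum_congr _ fun a b => ?_
    have e : g' (i a) (i b) = ((h (i a)).map (secRes inf_le_left))⁻¹ *
        (g (r (i a)) (r (i b))).map (secRes (inf_le_inf (hr _) (hr _))) *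
        (h (i b)).map (secRes inf_le_right) := hgg' _ _
    have e' := congrArg (fun N => N.map (secRes (le_inf (hV i a) (hV i b)))) e
    simp only [Matrix.map_mul] at e'
    rw [Matrix.map_ringHom_inv (secRes _) (Matrix.isUnit_map_ringHom (secRes _) (hu _)),
      map_secRes_secRes, map_secRes_secRes, map_secRes_secRes] at e'
    exact e'
  refine (congrArg₂ _ hT' ?_).trans (key.trans ?_)
  · refine (res_normTraceSum halg hres _ (hg.isUnit_grRes _) id).trans
      (normTraceSum_congr _ fun a b => (map_secRes_secRes _ _ _).trans ?_)
    simp [twistSystem, G, H]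
  · refine Finset.sum_congr rfl fun j _ => ?_
    have hHr (a : Fin k) (e : Bool) (hW : tupleInf V i ≤ tupleInf V fun l => i (j.succAbove l)) :
        (H (fun l => i (j.succAbove l)) a e).map (secRes hW) = H i (j.succAbove a) e := by
      cases e
      · exact Matrix.map_one _ (map_zero _) (map_one _)
      · exact map_secRes_secRes _ _ _
    refine congrArg (fun z => (-1 : ℤ) ^ (j : ℕ) • z) (Eq.symm ?_)
    rw [map_sum]
    refine Finset.sum_congr rfl fun l _ => ?_
    rw [map_zsmul]
    refine congrArg (fun z => (-1 : ℤ) ^ (l : ℕ) • z)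
      ((res_normTraceSum halg hres _ (isUnit_twistSystem (hG _) (hH _)) (prism id l)).trans
        (normTraceSum_congr _ fun a b => (twistSystem_map _ _ (hH _) _ _).trans ?_))
    exact congrArg₂ (· * ·) (congrArg₂ (· * ·) (congrArg (·⁻¹) (hHr _ _ _))
      (map_secRes_secRes _ _ _)) (hHr _ _ _)

theorem schCohomologous_of_schSystemsEquiv
    (halg : ∀ (U V : X.Opens) (h : V ≤ U) (a : K),
      X.presheaf.map (homOfLE h).op (algebraMap K _ a) = algebraMap K _ a)
    {res : ∀ (U V : X.Opens), V ≤ U → FormAlg K X U →+* FormAlg K X V}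
    (hres : IsFormRestriction (K := K) res) (k : ℕ) {M : ℕ} {ι : Type} {U : ι → X.Opens}
    {g : ∀ i j : ι, Matrix (Fin M) (Fin M) (X.presheaf.obj (op (U i ⊓ U j)))}
    (hg : IsSchTransition U g)
    (g' : ∀ i j : ι, Matrix (Fin M) (Fin M) (X.presheaf.obj (op (U i ⊓ U j))))
    (hgg' : SchSystemsEquiv U U id (fun j => le_refl _) g g') :
    SchCohomologous (K := K) U res k (schT (K := K) U g k) (schT (K := K) U g' k) := by
  obtain ⟨s, hs, hs'⟩ :=
    schCohomologous_of_refinement halg hres k hg U id (fun _ => le_refl _) g' hgg'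
  refine ⟨s, hs, fun i => ?_⟩
  rw [← hs' i]
  exact congrArg (fun z => schT (K := K) U g' k i - z) (res_schT_self halg hres k hg i _).symm

end

/-- Theorem 1.12: T invariants of locally free sheaves on schemes
over a field.  Let `X` be a scheme over a field `K` (given by compatible
`K`-algebra structures on the section rings), let `k ≥ 1` be such that `(k+2)!` is
not divisible by the characteristic of `K` (i.e. `(k+2)! ≠ 0` in `K`), and let `E`
be a locally free sheaf of rank `M` over `X` presented by a system `g` of
transition functions with respect to the Zariski open cover `U`.  Then the Čech
`k`-cochain `f̂_{k,𝒰}(E)` with components `t_{i₁⋯i_{k+1}}` defined by the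
combinatorial formula takes values in `Ω^k` and is a Čech `k`-cocycle; its class
`f_{k,𝒰}(E) ∈ Ȟ^k(𝒰, Ω^k)` is independent of the choice of `g` (any two systems,
related by a change of trivialization `h`, give cohomologous cocycles); and its
image `f_k(E)` in `Ȟ^k(X, Ω^k)` under the canonical homomorphism is independent of
the choice of `𝒰` (on any refinement, the restricted cocycle is cohomologous to the
cocycle of any system of transition functions of `E` on the refinement).  The class
`f_k(E)` is called the `k`-th T invariant of `E`. -/
theorem statement_10
    {K : Type} [Field K] {X : Scheme}
    [∀ U : X.Opens, Algebra K (X.presheaf.obj (op U))]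
    -- the `K`-algebra structures are compatible with restriction
    -- (this is the datum of a structure morphism `X → Spec K`):
    (halg : ∀ (U V : X.Opens) (h : V ≤ U) (a : K),
      X.presheaf.map (homOfLE h).op (algebraMap K _ a) = algebraMap K _ a)
    -- the canonical restriction maps of differential forms:
    (res : ∀ (U V : X.Opens), V ≤ U → FormAlg K X U →+* FormAlg K X V)
    (hres : IsFormRestriction (K := K) res)
    (k : ℕ) (hk : 1 ≤ k) (hchar : ((k+2).factorial : K) ≠ 0)
    {M : ℕ} {ι : Type} [LinearOrder ι] (U : ι → X.Opens)
    (hU : IsZariskiCover U)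
    (g : ∀ i j : ι, Matrix (Fin M) (Fin M) (X.presheaf.obj (op (U i ⊓ U j))))
    (hg : IsSchTransition U g) :
    -- the components of `f̂_{k,𝒰}(E)` are `k`-forms (sections of `Ω^k`):
    IsFormCochain (K := K) U k (schT (K := K) U g k) ∧
    -- `f̂_{k,𝒰}(E)` is a Čech `k`-cocycle:
    (∀ i : Fin (k+2) → ι, schD (K := K) U res (schT (K := K) U g k) i = 0) ∧
    -- its class in `Ȟ^k(𝒰, Ω^k)` is independent of the choice of `g`:
    (∀ g' : ∀ i j : ι, Matrix (Fin M) (Fin M) (X.presheaf.obj (op (U i ⊓ U j))),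
      IsSchTransition U g' →
      SchSystemsEquiv U U id (fun j => le_refl _) g g' →
      SchCohomologous (K := K) U res k (schT (K := K) U g k) (schT (K := K) U g' k)) ∧
    -- its image in `Ȟ^k(X, Ω^k)` is independent of the choice of `𝒰`:
    (∀ {κ : Type} (V : κ → X.Opens), IsZariskiCover V →
      ∀ (r : κ → ι) (hr : ∀ j, V j ≤ U (r j))
        (g' : ∀ i j : κ, Matrix (Fin M) (Fin M) (X.presheaf.obj (op (V i ⊓ V j)))),
        IsSchTransition V g' →
        SchSystemsEquiv U V r hr g g' →
        SchCohomologous (K := K) V res k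
          (fun i => res (tupleInf U fun l => r (i l)) (tupleInf V i)
            (le_iInf fun l => (iInf_le (fun l' => V (i l')) l).trans (hr (i l)))
            (schT (K := K) U g k (fun l => r (i l))))
          (schT (K := K) V g' k)) := by
  exact ⟨isFormCochain_schT U g k, schD_schT_eq_zero halg hres k hg,
    fun g' _ h => schCohomologous_of_schSystemsEquiv halg hres k hg g' h,
    fun V _ r hr g' _ h => schCohomologous_of_refinement halg hres k hg V r hr g' h⟩
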